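/- arXiv:1905.12782 — 3 statements merged into one kernel-verified Lean document; each statement's English description precedes it below -/
import Mathlib

section
/- Fix integers d ≥ 1, M ≥ 2, a real p ≥ 1, and h > 0. Let B_i = {x ∈ ℝ^d : ‖x − c_i‖_p ≤ r_i}, i = 1,…,M, be closed ℓ_p balls with radii r₁ > r₂ ≥ r₃ ≥ … ≥ r_M > 0 and centers satisfying ‖c_i − c_j‖_p ≥ D + 2r₁ for all i ≠ j. Assume r₁ ≤ h/2 and D > (h/2)·(ln M − ln(1 − (r₂/r₁)^d)). Then for every point v belonging to some ball B_j with j ≠ 1, the largest ball's center dominates v in score: ∫_{⋃_{i=1}^M B_i} exp(−(2/h)·‖x − c₁‖_p) dx ≥ ∫_{⋃_{i=1}^M B_i} exp(−(2/h)·‖x − v‖_p) dx, where the integrals are with respect to Lebesgue measure on ℝ^d. -/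
open MeasureTheory

/-- The ℓ_p norm of a vector in ℝ^d (for a real exponent `p ≥ 1`). -/
noncomputable def pNorm (p : ℝ) {d : ℕ} (v : Fin d → ℝ) : ℝ :=
  (∑ i, |v i| ^ p) ^ (1 / p)

section NormedSpace

variable {E : Type*} [NormedAddCommGroup E] [NormedSpace ℝ E] [FiniteDimensional ℝ E]
  [MeasurableSpace E] [BorelSpace E] (μ : Measure E) [μ.IsAddHaarMeasure]

theorem exp_mul_cosh_le {ρ m y r R : ℝ} (hρ : 0 < ρ) (hρ1 : ρ < 1) (hy : 0 ≤ y) (hyr : y ≤ r)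
    (hm : m ≤ r) (hrR : r ≤ R) (hR : R ≤ 1) :
    (1 - ρ) * (Real.exp (m - R) * Real.cosh y) ≤
      (1 - ρ) / ρ + 1 / 2 * max (1 - Real.exp (r - m - y)) 0 := by
  have key : Real.exp (m - R) * Real.cosh y =
      (Real.exp (m - R + y) + Real.exp (m - R - y)) / 2 := by
    rw [Real.cosh_eq, Real.exp_add, sub_eq_add_neg (m - R) y, Real.exp_add]
    ring
  have hinv : 1 ≤ 1 / ρ := by rw [le_div_iff₀ hρ]; linarith
  have hdiv : (1 - ρ) / ρ = (1 - ρ) * (1 / ρ) := by ring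
  rw [key, hdiv]
  rcases le_total (m + y) r with h | h
  · have h1 : Real.exp (m - R + y) ≤ 1 := Real.exp_le_one_iff.2 (by linarith)
    have h2 : Real.exp (m - R - y) ≤ 1 := Real.exp_le_one_iff.2 (by linarith)
    have h3 := le_max_right (1 - Real.exp (r - m - y)) 0
    have h4 := mul_le_mul_of_nonneg_left
      (show (Real.exp (m - R + y) + Real.exp (m - R - y)) / 2 ≤ 1 / ρ by linarith)
      (sub_nonneg.2 hρ1.le)
    linarith
  · set t := Real.exp (m + y - r) with ht
    have h1 : Real.exp (m - R + y) ≤ t := Real.exp_le_exp.2 (by linarith)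
    have h2 : Real.exp (m - R - y) ≤ t⁻¹ := by
      rw [ht, ← Real.exp_neg]; exact Real.exp_le_exp.2 (by linarith)
    have h3 : Real.exp (r - m - y) = t⁻¹ := by
      rw [ht, ← Real.exp_neg]; congr 1; ring
    have ht1 : 1 ≤ t := Real.one_le_exp (by linarith)
    have ht2 : t < 2.7182818286 :=
      (Real.exp_le_exp.2 (by linarith : m + y - r ≤ 1)).trans_lt Real.exp_one_lt_d9
    have hti : t⁻¹ ≤ 1 := inv_le_one_of_one_le₀ ht1
    have htt : t * t⁻¹ = 1 := mul_inv_cancel₀ (by positivity)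
    rw [h3]
    have h4 := le_max_left (1 - t⁻¹) 0
    have h5 : (1 - ρ) * ((Real.exp (m - R + y) + Real.exp (m - R - y)) / 2) ≤
        (1 - ρ) * ((t + t⁻¹) / 2) :=
      mul_le_mul_of_nonneg_left (by linarith) (by linarith)
    rcases le_total ρ (1 / 2) with h' | h'
    · have h6 : 2 ≤ 1 / ρ := by rw [le_div_iff₀ hρ]; linarith
      have h7 := mul_le_mul_of_nonneg_left
        (show (t + t⁻¹) / 2 ≤ 1 / ρ by linarith) (sub_nonneg.2 hρ1.le)
      linarith
    · have h6 := mul_le_mul_of_nonneg_left hinv (sub_nonneg.2 hρ1.le)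
      have h7 : (1 - ρ) * (t - 1) ≤ 1 := by nlinarith
      have h8 := mul_le_mul_of_nonneg_right h7 (sub_nonneg.2 hti)
      nlinarith

omit [NormedSpace ℝ E] [FiniteDimensional ℝ E] in
theorem setIntegral_closedBall_eq_translate (c : E) (t : ℝ) (g : E → ℝ) :
    ∫ x in Metric.closedBall c t, g x ∂μ = ∫ x in Metric.closedBall 0 t, g (x + c) ∂μ := by
  rw [← (measurePreserving_add_right μ c).setIntegral_preimage_emb
    (MeasurableEquiv.addRight c).measurableEmbedding g]
  congr 2
  ext x
  simp

theorem setIntegral_closedBall_zero_comp_neg (t : ℝ) (g : E → ℝ) :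
    ∫ x in Metric.closedBall 0 t, g (-x) ∂μ = ∫ x in Metric.closedBall 0 t, g x ∂μ := by
  rw [← (Measure.measurePreserving_neg μ).setIntegral_preimage_emb
    (MeasurableEquiv.neg E).measurableEmbedding g]
  congr 2
  ext x
  simp

theorem setIntegral_exp_neg_norm_sub_le (f : StrongDual ℝ E) (hf : ∀ x, f x ≤ ‖x‖) (c v : E)
    (t : ℝ) :
    ∫ x in Metric.closedBall c t, Real.exp (-‖x - v‖) ∂μ ≤
      Real.exp (-f (c - v)) * ∫ x in Metric.closedBall 0 t, Real.cosh (f x) ∂μ := by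
  have hi : ∀ {g : E → ℝ}, Continuous g → IntegrableOn g (Metric.closedBall 0 t) μ := fun hg =>
    hg.continuousOn.integrableOn_compact (isCompact_closedBall 0 t)
  have hcosh : ∫ x in Metric.closedBall 0 t, Real.cosh (f x) ∂μ =
      ∫ x in Metric.closedBall 0 t, Real.exp (-f x) ∂μ := by
    have h1 := setIntegral_closedBall_zero_comp_neg μ t fun x => Real.exp (-f x)
    simp only [map_neg, neg_neg] at h1
    simp_rw [Real.cosh_eq]
    rw [integral_div, integral_add (hi (by fun_prop)) (hi (by fun_prop)), h1]
    ring
  rw [setIntegral_closedBall_eq_translate, hcosh, ← integral_const_mul]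
  refine setIntegral_mono (hi (by fun_prop)) (hi (by fun_prop)) fun x => ?_
  rw [← Real.exp_add, Real.exp_le_exp]
  have := hf (x + c - v)
  rw [add_sub_assoc, map_add] at this
  rw [add_sub_assoc]
  linarith

theorem setIntegral_exp_neg_norm_sub_add_le (u : E) (r : ℝ) :
    ∫ x in Metric.closedBall 0 r, Real.exp (-‖x - u‖) ∂μ +
      ∫ x in Metric.closedBall 0 r, max (Real.exp (-r) - Real.exp (-‖x - u‖)) 0 ∂μ ≤
      ∫ x in Metric.closedBall 0 r, Real.exp (-‖x‖) ∂μ := by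
  have hi : ∀ {g : E → ℝ}, Continuous g → IntegrableOn g (Metric.closedBall 0 r) μ := fun hg =>
    hg.continuousOn.integrableOn_compact (isCompact_closedBall 0 r)
  set k : E → ℝ := fun x => max (Real.exp (-‖x‖) - Real.exp (-r)) 0 with hk
  have hkc : Continuous k := by fun_prop
  have hk0 : ∀ x, 0 ≤ k x := fun x => le_max_right _ _
  have hks : ∀ x, x ∉ Metric.closedBall (0 : E) r → k x = 0 := by
    intro x hx
    simp only [Metric.mem_closedBall, dist_zero_right, not_le] at hx
    exact max_eq_right (sub_nonpos.2 (Real.exp_le_exp.2 (by linarith)))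
  have hkint : Integrable k μ :=
    (integrableOn_iff_integrable_of_support_subset fun x hx => by
      by_contra h; exact hx (hks x h)).1 (hi hkc)
  have h1 : ∫ x in Metric.closedBall 0 r, k (x - u) ∂μ ≤
      ∫ x in Metric.closedBall 0 r, k x ∂μ :=
    calc _ ≤ ∫ x, k (x - u) ∂μ :=
          setIntegral_le_integral (hkint.comp_sub_right u) (.of_forall fun x => hk0 _)
      _ = ∫ x, k x ∂μ := integral_sub_right_eq_self k u
      _ = _ := (setIntegral_eq_integral_of_forall_compl_eq_zero hks).symm
  have h2 : ∫ x in Metric.closedBall 0 r, k x ∂μ =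
      ∫ x in Metric.closedBall 0 r, (Real.exp (-‖x‖) - Real.exp (-r)) ∂μ := by
    refine setIntegral_congr_fun Metric.isClosed_closedBall.measurableSet fun x hx => ?_
    simp only [Metric.mem_closedBall, dist_zero_right] at hx
    exact max_eq_left (sub_nonneg.2 (Real.exp_le_exp.2 (by linarith)))
  have h3 : ∫ x in Metric.closedBall 0 r, Real.exp (-‖x - u‖) ∂μ +
      ∫ x in Metric.closedBall 0 r, max (Real.exp (-r) - Real.exp (-‖x - u‖)) 0 ∂μ =
      ∫ x in Metric.closedBall 0 r, k (x - u) ∂μ +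
        ∫ x in Metric.closedBall 0 r, Real.exp (-r) ∂μ := by
    rw [← integral_add (hi (by fun_prop)) (hi (by fun_prop)),
      ← integral_add (hi (by fun_prop)) (hi (by fun_prop))]
    congr 1
    ext x
    simp only [hk]
    rcases le_total (Real.exp (-r)) (Real.exp (-‖x - u‖)) with h | h
    · rw [max_eq_right (by linarith), max_eq_left (by linarith)]; ring
    · rw [max_eq_left (by linarith), max_eq_right (by linarith)]; ring
  rw [integral_sub (hi (by fun_prop)) (hi (by fun_prop))] at h2
  linarith

theorem half_setIntegral_max_le (f : StrongDual ℝ E) (hf : ∀ x, f x ≤ ‖x‖) (u : E) (r : ℝ) :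
    Real.exp (-r) * (1 / 2 *
      ∫ x in Metric.closedBall 0 r, max (1 - Real.exp (r - f u - |f x|)) 0 ∂μ) ≤
      ∫ x in Metric.closedBall 0 r, max (Real.exp (-r) - Real.exp (-‖x - u‖)) 0 ∂μ := by
  have hi : ∀ {g : E → ℝ}, Continuous g → IntegrableOn g (Metric.closedBall 0 r) μ := fun hg =>
    hg.continuousOn.integrableOn_compact (isCompact_closedBall 0 r)
  set g : E → ℝ := fun x => max (Real.exp (-r) - Real.exp (-‖x - u‖)) 0 with hg
  have hgc : Continuous g := by fun_prop
  have hlow : ∀ x, Real.exp (-r) * max (1 - Real.exp (r - f u + f x)) 0 ≤ g x := by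
    intro x
    rw [mul_max_of_nonneg _ _ (Real.exp_pos _).le, mul_zero, mul_sub, mul_one, ← Real.exp_add]
    refine max_le_max_right _ (sub_le_sub_left (Real.exp_le_exp.2 ?_) _)
    have := hf (u - x)
    rw [map_sub, norm_sub_rev] at this
    linarith
  have hsum : ∀ x, Real.exp (-r) * max (1 - Real.exp (r - f u - |f x|)) 0 ≤ g x + g (-x) := by
    intro x
    have h1 := hlow x
    have h2 := hlow (-x)
    rw [map_neg] at h2
    rcases abs_cases (f x) with ⟨h, -⟩ | ⟨h, -⟩
    · rw [h, sub_eq_add_neg (r - f u)]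
      linarith [show 0 ≤ g x from le_max_right _ _]
    · rw [h, sub_neg_eq_add]
      linarith [show 0 ≤ g (-x) from le_max_right _ _]
  have h := setIntegral_mono (s := Metric.closedBall 0 r) (μ := μ)
    (hi (by fun_prop)) (hi (by fun_prop)) hsum
  rw [integral_add (hi (by fun_prop)) (hi (by fun_prop)), integral_const_mul,
    setIntegral_closedBall_zero_comp_neg] at h
  linarith

theorem setIntegral_iUnion_le_sum {ι X : Type*} [Fintype ι] [MeasurableSpace X] {ν : Measure X}
    {s : ι → Set X} {g : X → ℝ} (hg : ∀ x, 0 ≤ g x) (hi : ∀ i, IntegrableOn g (s i) ν) :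
    ∫ x in ⋃ i, s i, g x ∂ν ≤ ∑ i, ∫ x in s i, g x ∂ν := by
  rw [← integral_finsetSum_measure fun i _ => hi i, ← Measure.sum_fintype]
  refine integral_mono_measure Measure.restrict_iUnion_le (.of_forall hg) ?_
  rw [Measure.sum_fintype]
  exact (integrable_finsetSum_measure (s := Finset.univ)).2 fun i _ => hi i

theorem setIntegral_closedBall_zero_add_le {s R : ℝ} (hsR : s ≤ R) :
    ∫ x in Metric.closedBall 0 s, Real.exp (-‖x‖) ∂μ +
      Real.exp (-R) * (μ.real (Metric.closedBall 0 R) - μ.real (Metric.closedBall 0 s)) ≤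
      ∫ x in Metric.closedBall 0 R, Real.exp (-‖x‖) ∂μ := by
  have hi : ∀ {g : E → ℝ} (t : ℝ), Continuous g → IntegrableOn g (Metric.closedBall 0 t) μ :=
    fun t hg => hg.continuousOn.integrableOn_compact (isCompact_closedBall 0 t)
  have h := setIntegral_mono_set (μ := μ) (s := Metric.closedBall (0 : E) s)
    (t := Metric.closedBall 0 R) (f := fun x => Real.exp (-‖x‖) - Real.exp (-R))
    (hi R (by fun_prop))
    (ae_restrict_of_forall_mem Metric.isClosed_closedBall.measurableSet fun x hx => by
      simp only [Metric.mem_closedBall, dist_zero_right] at hx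
      exact sub_nonneg.2 (Real.exp_le_exp.2 (by linarith)))
    (Metric.closedBall_subset_closedBall hsR).eventuallyLE
  rw [integral_sub (hi s (by fun_prop)) (hi s (by fun_prop)),
    integral_sub (hi R (by fun_prop)) (hi R (by fun_prop)), setIntegral_const,
    setIntegral_const, smul_eq_mul, smul_eq_mul] at h
  linarith

/-- For well-separated balls in a normed space, the Laplace score at the center of the strictly
largest ball dominates the score at every point close to another center. -/
theorem setIntegral_iUnion_closedBall_exp_le {ι : Type*} [Fintype ι] (i₀ : ι)
    (c : ι → E) (t : ι → ℝ) {s R D : ℝ} (hs : 0 < s) (hsR : s < R) (hR : R ≤ 1)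
    (hE : Module.finrank ℝ E ≠ 0) (ht₀ : t i₀ = R) (ht : ∀ i, i ≠ i₀ → t i ≤ s)
    (hsep : ∀ i j, i ≠ j → D + 2 * R ≤ ‖c i - c j‖)
    (hD : Real.exp (-D) ≤ (1 - (s / R) ^ Module.finrank ℝ E) / Fintype.card ι)
    {j : ι} (hj : j ≠ i₀) {v : E} (hv : ‖v - c j‖ ≤ s) :
    ∫ x in ⋃ i, Metric.closedBall (c i) (t i), Real.exp (-‖x - v‖) ∂μ ≤
      ∫ x in ⋃ i, Metric.closedBall (c i) (t i), Real.exp (-‖x - c i₀‖) ∂μ := by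
  classical
  have hi : ∀ {g : E → ℝ} (y : E) (a : ℝ), Continuous g →
      IntegrableOn g (Metric.closedBall y a) μ :=
    fun y a hg => hg.continuousOn.integrableOn_compact (isCompact_closedBall y a)
  have hRpos : 0 < R := hs.trans hsR
  set ρ := (s / R) ^ Module.finrank ℝ E with hρdef
  have hρ : 0 < ρ := by positivity
  have hρ1 : ρ < 1 := pow_lt_one₀ (by positivity) ((div_lt_one hRpos).2 hsR) hE
  set b := μ.real (Metric.closedBall (0 : E) R) with hb
  have hbs : μ.real (Metric.closedBall (0 : E) s) = ρ * b := by
    rw [hb, Measure.addHaar_real_closedBall' μ 0 hs.le,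
      Measure.addHaar_real_closedBall' μ 0 hRpos.le, hρdef, div_pow]
    field_simp
  set K := Real.exp (-R) * ((1 - ρ) * b) with hK
  set Δ := ∫ x in Metric.closedBall 0 s,
    max (Real.exp (-s) - Real.exp (-‖x - (v - c j)‖)) 0 ∂μ with hΔ
  have hΔ0 : 0 ≤ Δ := integral_nonneg fun x => le_max_right _ _
  set F := ∫ x in Metric.closedBall 0 s, Real.exp (-‖x‖) ∂μ with hF
  set n : ℝ := (Fintype.card ι : ℝ) with hn
  have hn0 : 0 < n := Nat.cast_pos.2 (Fintype.card_pos_iff.2 ⟨i₀⟩)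
  have hright : F + K ≤
      ∫ x in ⋃ i, Metric.closedBall (c i) (t i), Real.exp (-‖x - c i₀‖) ∂μ := by
    have h1 := setIntegral_closedBall_zero_add_le μ hsR.le
    rw [hbs, ← hb, ← hF] at h1
    have h2 : ∫ x in Metric.closedBall 0 R, Real.exp (-‖x‖) ∂μ =
        ∫ x in Metric.closedBall (c i₀) (t i₀), Real.exp (-‖x - c i₀‖) ∂μ := by
      rw [setIntegral_closedBall_eq_translate μ (c i₀), ht₀]
      simp
    have h3 : ∫ x in Metric.closedBall (c i₀) (t i₀), Real.exp (-‖x - c i₀‖) ∂μ ≤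
        ∫ x in ⋃ i, Metric.closedBall (c i) (t i), Real.exp (-‖x - c i₀‖) ∂μ :=
      setIntegral_mono_set (integrableOn_finite_iUnion.2 fun i => hi _ _ (by fun_prop))
        (.of_forall fun x => (Real.exp_pos _).le)
        (Set.subset_iUnion (fun i => Metric.closedBall (c i) (t i)) i₀).eventuallyLE
    rw [hK]
    linarith
  have hgrow : ∀ i, i ≠ i₀ → ∫ x in Metric.closedBall (c i) (t i), Real.exp (-‖x - v‖) ∂μ ≤
      ∫ x in Metric.closedBall (c i) s, Real.exp (-‖x - v‖) ∂μ := fun i hi0 =>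
    setIntegral_mono_set (hi _ _ (by fun_prop)) (.of_forall fun x => (Real.exp_pos _).le)
      (Metric.closedBall_subset_closedBall (ht i hi0)).eventuallyLE
  have hown : ∫ x in Metric.closedBall (c j) (t j), Real.exp (-‖x - v‖) ∂μ ≤ F - Δ := by
    refine (hgrow j hj).trans ?_
    have h := setIntegral_exp_neg_norm_sub_add_le μ (v - c j) s
    rw [setIntegral_closedBall_eq_translate]
    simp_rw [show ∀ x, x + c j - v = x - (v - c j) from fun x => by abel]
    linarith
  have hfar : ∀ i, i ≠ j → ∃ f : StrongDual ℝ E, (∀ x, |f x| ≤ ‖x‖) ∧ ∀ a,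
      ∫ x in Metric.closedBall (c i) a, Real.exp (-‖x - v‖) ∂μ ≤
        (1 - ρ) / n * Real.exp (-R) * (Real.exp (f (v - c j) - R) *
          ∫ x in Metric.closedBall 0 a, Real.cosh (f x) ∂μ) := by
    intro i hij
    obtain ⟨f, hf1, hf2⟩ := exists_dual_vector'' ℝ (c i - c j)
    have hf : ∀ x, |f x| ≤ ‖x‖ := fun x =>
      (f.le_of_opNorm_le hf1 x).trans_eq (one_mul _)
    refine ⟨f, hf, fun a => ?_⟩
    refine (setIntegral_exp_neg_norm_sub_le μ f (fun x => (le_abs_self _).trans (hf x))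
      (c i) v a).trans ?_
    rw [← mul_assoc]
    refine mul_le_mul_of_nonneg_right ?_ (integral_nonneg fun x => (Real.cosh_pos _).le)
    have h1 : Real.exp (-f (c i - v)) ≤
        Real.exp (-D) * Real.exp (-R) * Real.exp (f (v - c j) - R) := by
      rw [← Real.exp_add, ← Real.exp_add, Real.exp_le_exp,
        show c i - v = (c i - c j) - (v - c j) by abel, map_sub, hf2]
      have := hsep i j hij
      simp only [RCLike.ofReal_real_eq_id, id_eq]
      linarith
    exact h1.trans (by gcongr)
  have hbig : ∫ x in Metric.closedBall (c i₀) (t i₀), Real.exp (-‖x - v‖) ∂μ ≤ 2 * K / n := by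
    obtain ⟨f, hf, hint⟩ := hfar i₀ hj.symm
    have h1 : Real.exp (f (v - c j) - R) ≤ 1 :=
      Real.exp_le_one_iff.2 (by linarith [(le_abs_self _).trans (hf (v - c j))])
    have h2 : ∫ x in Metric.closedBall 0 R, Real.cosh (f x) ∂μ ≤
        ∫ x in Metric.closedBall (0 : E) R, (2 : ℝ) ∂μ := by
      refine setIntegral_mono_on (hi _ _ (by fun_prop)) (hi _ _ (by fun_prop))
        Metric.isClosed_closedBall.measurableSet fun x hx => ?_
      simp only [Metric.mem_closedBall, dist_zero_right] at hx
      have h3 : Real.cosh (f x) ≤ Real.cosh 1 :=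
        Real.cosh_le_cosh.2 (by rw [abs_one]; linarith [hf x])
      have h4 : Real.cosh 1 ≤ 2 := by
        rw [Real.cosh_eq]
        linarith [Real.exp_one_lt_d9, Real.exp_le_one_iff.2 (show (-1 : ℝ) ≤ 0 by norm_num)]
      exact h3.trans h4
    rw [setIntegral_const, smul_eq_mul, ← hb] at h2
    have h5 : Real.exp (f (v - c j) - R) * ∫ x in Metric.closedBall 0 R, Real.cosh (f x) ∂μ ≤
        1 * (b * 2) :=
      mul_le_mul h1 h2 (integral_nonneg fun x => (Real.cosh_pos _).le) zero_le_one
    rw [ht₀]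
    have h6 : 0 ≤ (1 - ρ) / n * Real.exp (-R) :=
      mul_nonneg (div_nonneg (by linarith) hn0.le) (Real.exp_pos _).le
    refine (hint R).trans ((mul_le_mul_of_nonneg_left h5 h6).trans_eq ?_)
    rw [hK]
    ring
  have hother : ∀ i, i ≠ i₀ → i ≠ j →
      ∫ x in Metric.closedBall (c i) (t i), Real.exp (-‖x - v‖) ∂μ ≤ (K + Δ) / n := by
    intro i hi0 hij
    obtain ⟨f, hf, hint⟩ := hfar i hij
    refine (hgrow i hi0).trans ((hint s).trans ?_)
    have hfv := (le_abs_self _).trans ((hf (v - c j)).trans hv)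
    have h1 : ∫ x in Metric.closedBall 0 s,
          (1 - ρ) * (Real.exp (f (v - c j) - R) * Real.cosh (f x)) ∂μ ≤
        ∫ x in Metric.closedBall 0 s, ((1 - ρ) / ρ +
          1 / 2 * max (1 - Real.exp (s - f (v - c j) - |f x|)) 0) ∂μ := by
      refine setIntegral_mono_on (hi _ _ (by fun_prop)) (hi _ _ (by fun_prop))
        Metric.isClosed_closedBall.measurableSet fun x hx => ?_
      simp only [Metric.mem_closedBall, dist_zero_right] at hx
      rw [← Real.cosh_abs (f x)]
      exact exp_mul_cosh_le hρ hρ1 (abs_nonneg _) ((hf x).trans hx) hfv hsR.le hR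
    rw [integral_const_mul, integral_const_mul,
      integral_add (hi _ _ (by fun_prop)) (hi _ _ (by fun_prop)), setIntegral_const,
      integral_const_mul, hbs, smul_eq_mul,
      show ρ * b * ((1 - ρ) / ρ) = (1 - ρ) * b by field_simp] at h1
    have h2 := half_setIntegral_max_le μ f (fun x => (le_abs_self _).trans (hf x)) (v - c j) s
    rw [← hΔ] at h2
    set I := ∫ x in Metric.closedBall 0 s, max (1 - Real.exp (s - f (v - c j) - |f x|)) 0 ∂μ
      with hI
    have hI0 : 0 ≤ I := integral_nonneg fun x => le_max_right _ _
    have h3 : Real.exp (-R) * (1 / 2 * I) ≤ Real.exp (-s) * (1 / 2 * I) :=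
      mul_le_mul_of_nonneg_right (Real.exp_le_exp.2 (by linarith)) (by positivity)
    have h4 := mul_le_mul_of_nonneg_left h1 (Real.exp_pos (-R)).le
    rw [mul_add, ← hK] at h4
    rw [le_div_iff₀ hn0]
    refine le_trans (le_of_eq ?_) (h4.trans (by linarith))
    field_simp
  refine (setIntegral_iUnion_le_sum (fun x => (Real.exp_pos _).le)
    fun i => hi _ _ (by fun_prop)).trans (le_trans ?_ hright)
  have hterm : ∀ i, ∫ x in Metric.closedBall (c i) (t i), Real.exp (-‖x - v‖) ∂μ ≤
      (K + Δ) / n + (if i = j then F - Δ - (K + Δ) / n else 0) +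
        (if i = i₀ then 2 * K / n - (K + Δ) / n else 0) := by
    intro i
    by_cases h1 : i = j
    · subst h1
      rw [if_pos rfl, if_neg hj]
      linarith
    · rw [if_neg h1]
      by_cases h2 : i = i₀
      · subst h2
        rw [if_pos rfl]
        linarith
      · rw [if_neg h2]
        linarith [hother i h2 h1]
  refine (Finset.sum_le_sum fun i _ => hterm i).trans ?_
  rw [Finset.sum_add_distrib, Finset.sum_add_distrib, Finset.sum_ite_eq', Finset.sum_ite_eq',
    if_pos (Finset.mem_univ _), if_pos (Finset.mem_univ _), Finset.sum_const, nsmul_eq_mul,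
    Finset.card_univ, ← hn]
  have h1 : n * ((K + Δ) / n) = K + Δ := by field_simp
  have h2 : 2 * K / n - (K + Δ) / n - (K + Δ) / n = -(2 * Δ / n) := by ring
  have h3 : 0 ≤ 2 * Δ / n := by positivity
  linarith

end NormedSpace

/-- A linear identification of `ℝ^d` with `PiLp` under which the norm is `α` times `pNorm p`. -/
theorem exists_continuousLinearEquiv_norm_eq {α p : ℝ} (hα : 0 < α) (hp : 1 ≤ p) (d : ℕ)
    [Fact (1 ≤ ENNReal.ofReal p)] :
    ∃ e : (Fin d → ℝ) ≃L[ℝ] PiLp (ENNReal.ofReal p) fun _ : Fin d => ℝ,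
      ∀ x, ‖e x‖ = α * pNorm p x := by
  have hp0 : 0 ≤ p := by linarith
  refine ⟨(PiLp.continuousLinearEquiv (ENNReal.ofReal p) ℝ fun _ : Fin d => ℝ).symm.trans
    (ContinuousLinearEquiv.smulLeft (Units.mk0 α hα.ne')), fun x => ?_⟩
  have h1 : ‖WithLp.toLp (ENNReal.ofReal p) x‖ = pNorm p x := by
    rw [PiLp.norm_eq_sum (by rw [ENNReal.toReal_ofReal hp0]; linarith),
      ENNReal.toReal_ofReal hp0]
    rfl
  calc _ = ‖α • WithLp.toLp (ENNReal.ofReal p) x‖ := rfl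
    _ = α * pNorm p x := by rw [norm_smul, Real.norm_of_nonneg hα.le, h1]

/-- For clustered data uniform over a union of well-separated ℓ_p balls, the center of the
largest ball dominates, in data-based score, every point of every other ball: the score of a
candidate point `u` is `∫_{⋃ B_i} exp(−(2/h)‖x − u‖_p) dx` (up to a common constant). -/
theorem first_point_in_largest_ball (d M : ℕ) (hd : 1 ≤ d) (hM : 2 ≤ M)
    (p h D : ℝ) (hp : 1 ≤ p) (hh : 0 < h)
    (c : Fin M → (Fin d → ℝ)) (r : Fin M → ℝ)
    (hrpos : ∀ i, 0 < r i)
    (hrmono : ∀ i j : Fin M, i ≤ j → r j ≤ r i)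
    (hrstrict : r ⟨1, by omega⟩ < r ⟨0, by omega⟩)
    (hsep : ∀ i j : Fin M, i ≠ j → D + 2 * r ⟨0, by omega⟩ ≤ pNorm p (c i - c j))
    (hr0h : r ⟨0, by omega⟩ ≤ h / 2)
    (hD : (h / 2) * (Real.log M -
        Real.log (1 - (r ⟨1, by omega⟩ / r ⟨0, by omega⟩) ^ (d : ℝ))) < D) :
    ∀ j : Fin M, j ≠ ⟨0, by omega⟩ → ∀ v : Fin d → ℝ, pNorm p (v - c j) ≤ r j →
      (∫ x in ⋃ i : Fin M, {z : Fin d → ℝ | pNorm p (z - c i) ≤ r i},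
          Real.exp (-(2 / h) * pNorm p (x - v)))
        ≤ ∫ x in ⋃ i : Fin M, {z : Fin d → ℝ | pNorm p (z - c i) ≤ r i},
          Real.exp (-(2 / h) * pNorm p (x - c ⟨0, by omega⟩)) := by
  intro j hj v hv
  have hq : Fact (1 ≤ ENNReal.ofReal p) := ⟨ENNReal.one_le_ofReal.2 hp⟩
  have hα : 0 < 2 / h := by positivity
  obtain ⟨e, he⟩ := exists_continuousLinearEquiv_norm_eq hα hp d
  set R := r ⟨0, by omega⟩ with hR
  set s := r ⟨1, by omega⟩ with hs
  have hRpos : 0 < R := hrpos _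
  have hspos : 0 < s := hrpos _
  have hm : MeasurePreserving e volume (volume.map e) := e.continuous.measurable.measurePreserving _
  have htransfer : ∀ u : Fin d → ℝ,
      ∫ x in ⋃ i : Fin M, {z : Fin d → ℝ | pNorm p (z - c i) ≤ r i},
          Real.exp (-(2 / h) * pNorm p (x - u)) =
        ∫ x in ⋃ i, Metric.closedBall (e (c i)) (2 / h * r i), Real.exp (-‖x - e u‖)
          ∂(volume.map e) := by
    intro u
    rw [← hm.setIntegral_preimage_emb e.toHomeomorph.measurableEmbedding, Set.preimage_iUnion]
    simp_rw [← map_sub, he, neg_mul]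
    congr 3
    ext i x
    simp [dist_eq_norm, ← map_sub, he, hα]
  rw [htransfer, htransfer]
  have hfin : Module.finrank ℝ (PiLp (ENNReal.ofReal p) fun _ : Fin d => ℝ) = d := by
    rw [← e.toLinearEquiv.finrank_eq, Module.finrank_fin_fun]
  have hρ1 : (s / R) ^ d < 1 :=
    pow_lt_one₀ (by positivity) ((div_lt_one hRpos).2 hrstrict) (by omega)
  have hM0 : (0 : ℝ) < M := by exact_mod_cast (by omega : 0 < M)
  refine setIntegral_iUnion_closedBall_exp_le (volume.map e) ⟨0, by omega⟩ (fun i => e (c i))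
    (fun i => 2 / h * r i) (s := 2 / h * s) (R := 2 / h * R) (D := 2 / h * D) (by positivity)
    (mul_lt_mul_of_pos_left hrstrict hα) ?_ (by omega) rfl ?_ ?_ ?_ hj ?_
  · calc 2 / h * R ≤ 2 / h * (h / 2) := mul_le_mul_of_nonneg_left hr0h hα.le
      _ = 1 := by field_simp
  · intro i hi
    refine mul_le_mul_of_nonneg_left (hrmono _ _ ?_) hα.le
    rw [Fin.le_def]
    have : i.val ≠ 0 := fun h0 => hi (Fin.ext h0)
    show 1 ≤ i.val
    omega
  · intro i k hik
    rw [← map_sub, he]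
    calc 2 / h * D + 2 * (2 / h * R) = 2 / h * (D + 2 * R) := by ring
      _ ≤ _ := mul_le_mul_of_nonneg_left (hsep i k hik) hα.le
  · rw [hfin, Fintype.card_fin, mul_div_mul_left _ _ hα.ne']
    rw [Real.rpow_natCast] at hD
    have hlog : -(2 / h * D) ≤ Real.log ((1 - (s / R) ^ d) / M) := by
      rw [Real.log_div (by linarith) hM0.ne']
      have h1 := mul_lt_mul_of_pos_left hD hα
      rw [← mul_assoc, show 2 / h * (h / 2) = 1 by field_simp, one_mul] at h1
      linarith
    exact (Real.le_log_iff_exp_le (div_pos (by linarith) hM0)).1 hlog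
  · rw [← map_sub, he]
    refine mul_le_mul_of_nonneg_left (hv.trans (hrmono _ _ ?_)) hα.le
    rw [Fin.le_def]
    have : j.val ≠ 0 := fun h0 => hj (Fin.ext h0)
    show 1 ≤ j.val
    omega
end

section
/- Fix d ≥ 1, p ≥ 1, h > 0, r > 0, c ∈ ℝ^d, and let B = {x ∈ ℝ^d : ‖x − c‖_p ≤ r}. Then for every v ∈ B, ∫_B exp(−‖x − v‖_p/h) dx ≤ ∫_B exp(−‖x − c‖_p/h) dx, where the integrals are with respect to Lebesgue measure on ℝ^d; i.e., among points of the ball, the center maximizes the integral of the Laplace kernel over the ball. -/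
open MeasureTheory

/-- Bathtub principle: among sets of a given finite measure, a superlevel set of `f` maximizes
the integral of `f`. -/
theorem setIntegral_le_setIntegral_of_superlevel {α : Type*} [MeasurableSpace α]
    {μ : Measure α} {f : α → ℝ} {A B : Set α} {K : ℝ} (hA : MeasurableSet A)
    (hB : MeasurableSet B) (hfA : IntegrableOn f A μ) (hfB : IntegrableOn f B μ)
    (hAB : μ A = μ B) (hfin : μ B ≠ ⊤) (hK : ∀ x ∈ B, K ≤ f x) (hK' : ∀ x ∉ B, f x ≤ K) :
    ∫ x in A, f x ∂μ ≤ ∫ x in B, f x ∂μ := by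
  have hcA : IntegrableOn (fun _ => K) A μ := integrableOn_const (hAB ▸ hfin)
  have hcB : IntegrableOn (fun _ => K) B μ := integrableOn_const hfin
  have key : ∫ x in A, (f x - K) ∂μ ≤ ∫ x in B, (f x - K) ∂μ := by
    rw [← integral_indicator hA, ← integral_indicator hB]
    refine integral_mono ((integrable_indicator_iff hA).2 (hfA.sub hcA))
      ((integrable_indicator_iff hB).2 (hfB.sub hcB)) fun x => ?_
    by_cases hxB : x ∈ B
    · by_cases hxA : x ∈ A
      · simp [hxA, hxB]
      · simpa [hxA, hxB] using hK x hxB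
    · by_cases hxA : x ∈ A
      · simpa [hxA, hxB] using hK' x hxB
      · simp [hxA, hxB]
  rw [integral_sub hfA hcA, integral_sub hfB hcB] at key
  simpa [Measure.real, hAB] using key

theorem continuous_pNorm {p : ℝ} (hp : 0 ≤ p) {d : ℕ} :
    Continuous (pNorm p : (Fin d → ℝ) → ℝ) := by
  unfold pNorm
  refine Continuous.rpow_const ?_ fun _ => Or.inr (by positivity)
  exact continuous_finsetSum _ fun i _ =>
    (continuous_apply i).abs.rpow_const fun _ => Or.inr hp

theorem abs_apply_le_pNorm {p : ℝ} (hp : 0 < p) {d : ℕ} (v : Fin d → ℝ) (i : Fin d) :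
    |v i| ≤ pNorm p v := by
  have hsum : |v i| ^ p ≤ ∑ j, |v j| ^ p :=
    Finset.single_le_sum (f := fun j => |v j| ^ p)
      (fun j _ => Real.rpow_nonneg (abs_nonneg _) p) (Finset.mem_univ i)
  calc |v i| = (|v i| ^ p) ^ (1 / p) := by
        rw [← Real.rpow_mul (abs_nonneg _), mul_one_div_cancel hp.ne', Real.rpow_one]
    _ ≤ pNorm p v := Real.rpow_le_rpow (by positivity) hsum (by positivity)

theorem pNorm_sublevel_subset_closedBall {p : ℝ} (hp : 0 < p) {d : ℕ} {r : ℝ} (hr : 0 ≤ r)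
    (c : Fin d → ℝ) : {z | pNorm p (z - c) ≤ r} ⊆ Metric.closedBall c r := by
  intro z hz
  rw [mem_closedBall_iff_norm, pi_norm_le_iff_of_nonneg hr]
  exact fun i => (abs_apply_le_pNorm hp (z - c) i).trans hz

theorem measurableSet_pNorm_sublevel {p : ℝ} (hp : 0 ≤ p) {d : ℕ} (r : ℝ) (c : Fin d → ℝ) :
    MeasurableSet {z | pNorm p (z - c) ≤ r} :=
  (isClosed_le ((continuous_pNorm hp).comp (continuous_id.sub continuous_const))
    continuous_const).measurableSet

theorem setIntegral_pNorm_sublevel_comp_sub {p : ℝ} (hp : 0 ≤ p) {d : ℕ} (r : ℝ)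
    (c v : Fin d → ℝ) (f : (Fin d → ℝ) → ℝ) :
    ∫ x in {z | pNorm p (z - c) ≤ r}, f (x - v) =
      ∫ x in {z | pNorm p (z - (c - v)) ≤ r}, f x := by
  rw [← integral_indicator (measurableSet_pNorm_sublevel hp r c),
    ← integral_indicator (measurableSet_pNorm_sublevel hp r (c - v)),
    ← integral_add_right_eq_self (Set.indicator _ fun x => f (x - v)) v]
  refine integral_congr_ae (.of_forall fun x => ?_)
  simp [Set.indicator, sub_sub_eq_add_sub]

theorem volume_pNorm_sublevel (p : ℝ) {d : ℕ} (r : ℝ) (c : Fin d → ℝ) :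
    volume {z | pNorm p (z - c) ≤ r} = volume {z : Fin d → ℝ | pNorm p z ≤ r} := by
  simpa [sub_eq_add_neg] using
    measure_preimage_add_right volume (-c) {z : Fin d → ℝ | pNorm p z ≤ r}

/-- Among points of a closed ℓ_p ball, the center maximizes the integral of the Laplace
kernel over the ball. -/
theorem laplace_integral_center_max (d : ℕ) (hd : 1 ≤ d)
    (p h r : ℝ) (hp : 1 ≤ p) (hh : 0 < h) (hr : 0 < r) (c : Fin d → ℝ) :
    ∀ v : Fin d → ℝ, pNorm p (v - c) ≤ r →
      (∫ x in {z : Fin d → ℝ | pNorm p (z - c) ≤ r}, Real.exp (-pNorm p (x - v) / h))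
        ≤ ∫ x in {z : Fin d → ℝ | pNorm p (z - c) ≤ r}, Real.exp (-pNorm p (x - c) / h) := by
  intro v _
  have hp0 : 0 < p := by linarith
  have hcont : Continuous fun x : Fin d → ℝ => Real.exp (-pNorm p x / h) :=
    Real.continuous_exp.comp ((continuous_pNorm hp0.le).neg.div_const h)
  have hint (a : Fin d → ℝ) : IntegrableOn (fun x => Real.exp (-pNorm p x / h))
      {z | pNorm p (z - a) ≤ r} :=
    (hcont.continuousOn.integrableOn_compact (isCompact_closedBall a r)).mono_set
      (pNorm_sublevel_subset_closedBall hp0 hr.le a)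
  rw [setIntegral_pNorm_sublevel_comp_sub hp0.le r c v fun x => Real.exp (-pNorm p x / h),
    setIntegral_pNorm_sublevel_comp_sub hp0.le r c c fun x => Real.exp (-pNorm p x / h)]
  refine setIntegral_le_setIntegral_of_superlevel (K := Real.exp (-r / h))
    (measurableSet_pNorm_sublevel hp0.le r _) (measurableSet_pNorm_sublevel hp0.le r _)
    (hint _) (hint _) ((volume_pNorm_sublevel p r _).trans (volume_pNorm_sublevel p r _).symm)
    ?_ (fun x hx => ?_) fun x hx => ?_
  · exact ((measure_mono (pNorm_sublevel_subset_closedBall hp0 hr.le _)).trans_lt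
      measure_closedBall_lt_top).ne
  · simp only [sub_self, sub_zero, Set.mem_ofPred_eq] at hx
    gcongr
  · simp only [sub_self, sub_zero, Set.mem_ofPred_eq, not_le] at hx
    gcongr
end

section
/- Fix d ≥ 1, p ≥ 1, h > 0, r > 0 with r < h/3, an integer L ≥ 1, and D > 12·h·ln(2(L+1)). Let x₁,…,x_L ∈ ℝ^d satisfy ‖x_i − x_j‖_p ≥ D for all i ≠ j, with labels y ∈ {−1,+1}^L, and let u ∈ ℝ^d satisfy ‖u − x_L‖_p ≤ 2r and ‖u − x_i‖_p ≥ D for all i < L. Let K be the L×L matrix K_{ij} = exp(−‖x_i − x_j‖_p/h) and let a_u ∈ ℝ^L have entries (a_u)_i = exp(−‖x_i − u‖_p/h). Then K is invertible and y_L · (yᵀ K⁻¹ a_u) ≥ 0; i.e., the minimum-norm Laplace-kernel interpolant f(x) = yᵀK⁻¹a_x evaluated at u has the same sign as the label of the nearby labeled point x_L, so the maximin label estimate at u equals y_L. -/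
open Matrix

theorem pNorm_zero {p : ℝ} (hp : p ≠ 0) {d : ℕ} : pNorm p (0 : Fin d → ℝ) = 0 := by
  simp [pNorm, Real.zero_rpow hp, Real.zero_rpow (inv_ne_zero hp)]

theorem pNorm_nonneg (p : ℝ) {d : ℕ} (v : Fin d → ℝ) : 0 ≤ pNorm p v := by
  unfold pNorm
  positivity

theorem pNorm_sub_comm (p : ℝ) {d : ℕ} (v w : Fin d → ℝ) :
    pNorm p (v - w) = pNorm p (w - v) := by
  simp [pNorm, abs_sub_comm]

section DiagonallyDominant

variable {ι : Type*} [Fintype ι] [DecidableEq ι]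

theorem sum_erase_le_card_mul {f : ι → ℝ} {c : ℝ} (hc : 0 ≤ c) (i : ι)
    (hf : ∀ j, j ≠ i → f j ≤ c) :
    ∑ j ∈ Finset.univ.erase i, f j ≤ Fintype.card ι * c := by
  calc ∑ j ∈ Finset.univ.erase i, f j
      ≤ ∑ _j ∈ Finset.univ.erase i, c :=
        Finset.sum_le_sum fun j hj => hf j (Finset.ne_of_mem_erase hj)
    _ ≤ ∑ _j : ι, c :=
        Finset.sum_le_sum_of_subset_of_nonneg (Finset.erase_subset _ _) fun _ _ _ => hc
    _ = Fintype.card ι * c := by simp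

variable {K : Matrix ι ι ℝ} {ε : ℝ}

theorem isUnit_det_of_diag_one_of_offDiag_le (hdiag : ∀ i, K i i = 1)
    (hoff : ∀ i j, i ≠ j → |K i j| ≤ ε) (hε : 0 ≤ ε) (hcard : Fintype.card ι * ε ≤ 1 / 2) :
    IsUnit K.det := by
  refine isUnit_iff_ne_zero.2 (det_ne_zero_of_sum_row_lt_diag fun i => ?_)
  have := sum_erase_le_card_mul (f := fun j => ‖K i j‖) hε i fun j hj => hoff i j hj.symm
  rw [hdiag, norm_one]
  linarith

/-- If `K` is close to the identity, the solution of `K w = a` is close to `a`. -/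
theorem abs_sub_le_of_mulVec_eq (hdiag : ∀ i, K i i = 1)
    (hoff : ∀ i j, i ≠ j → |K i j| ≤ ε) (hε : 0 ≤ ε) (hcard : Fintype.card ι * ε ≤ 1 / 2)
    {a w : ι → ℝ} (ha : ∀ i, |a i| ≤ 1) (hw : K *ᵥ w = a) (i : ι) :
    |w i - a i| ≤ 2 * (Fintype.card ι * ε) := by
  have : Nonempty ι := ⟨i⟩
  obtain ⟨m, hm⟩ := Finite.exists_max fun j => |w j|
  have key : ∀ j, |w j - a j| ≤ Fintype.card ι * ε * |w m| := by
    intro j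
    have hsum : a j = w j + ∑ k ∈ Finset.univ.erase j, K j k * w k := by
      rw [← hw, mulVec, dotProduct, ← Finset.add_sum_erase _ _ (Finset.mem_univ j), hdiag, one_mul]
    have hsub : w j - a j = -∑ k ∈ Finset.univ.erase j, K j k * w k := by rw [hsum]; ring
    rw [hsub, abs_neg, mul_assoc]
    refine (Finset.abs_sum_le_sum_abs _ _).trans
      (sum_erase_le_card_mul (by positivity) j fun k hk => ?_)
    rw [abs_mul]
    exact mul_le_mul (hoff j k hk.symm) (hm k) (abs_nonneg _) hε
  have hM : |w m| ≤ 2 := by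
    have htri : |w m| ≤ |w m - a m| + |a m| := by simpa using abs_add_le (w m - a m) (a m)
    nlinarith [key m, ha m, abs_nonneg (w m)]
  have hnonneg : 0 ≤ Fintype.card ι * ε := by positivity
  nlinarith [key i]

/-- The interpolant with labels of absolute value one keeps the sign of the label `y l` where the
kernel vector `a` is concentrated at `l`. -/
theorem mul_dotProduct_inv_mulVec_nonneg (hdiag : ∀ i, K i i = 1)
    (hoff : ∀ i j, i ≠ j → |K i j| ≤ ε) (hε : 0 ≤ ε)
    (hcard : 15 * (Fintype.card ι : ℝ) ^ 2 * ε ≤ 1)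
    {a y : ι → ℝ} (ha : ∀ i, |a i| ≤ 1) (l : ι) (hal : 1 / 3 ≤ a l)
    (ha_off : ∀ i, i ≠ l → |a i| ≤ ε) (hy : ∀ i, y i = 1 ∨ y i = -1) :
    0 ≤ y l * (y ⬝ᵥ K⁻¹ *ᵥ a) := by
  have hN : (1 : ℝ) ≤ Fintype.card ι := by
    exact_mod_cast Fintype.card_pos_iff.2 ⟨l⟩
  have hNε : Fintype.card ι * ε ≤ (Fintype.card ι : ℝ) ^ 2 * ε := by
    gcongr
    nlinarith
  have hεN : ε ≤ Fintype.card ι * ε := le_mul_of_one_le_left hε hN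
  have hhalf : Fintype.card ι * ε ≤ 1 / 2 := by linarith
  have hdet := isUnit_det_of_diag_one_of_offDiag_le hdiag hoff hε hhalf
  set w := K⁻¹ *ᵥ a with hw_def
  have hw : K *ᵥ w = a := by
    rw [hw_def, mulVec_mulVec, mul_nonsing_inv _ hdet, one_mulVec]
  have hclose := abs_sub_le_of_mulVec_eq hdiag hoff hε hhalf ha hw
  have habs : ∀ i, |y i| = 1 := fun i => by rcases hy i with h | h <;> simp [h]
  have hsq : y l * y l = 1 := by rcases hy l with h | h <;> simp [h]
  have hexpand : y l * (y ⬝ᵥ w) =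
      w l + ∑ i ∈ Finset.univ.erase l, y l * (y i * w i) := by
    rw [dotProduct, ← Finset.add_sum_erase _ _ (Finset.mem_univ l), mul_add, Finset.mul_sum,
      ← mul_assoc, hsq, one_mul]
  have hrest : |∑ i ∈ Finset.univ.erase l, y l * (y i * w i)| ≤
      Fintype.card ι * (3 * (Fintype.card ι * ε)) := by
    refine (Finset.abs_sum_le_sum_abs _ _).trans
      (sum_erase_le_card_mul (by positivity) l fun i hi => ?_)
    rw [abs_mul, abs_mul, habs, habs, one_mul, one_mul]
    have htri : |w i| ≤ |w i - a i| + |a i| := by simpa using abs_add_le (w i - a i) (a i)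
    linarith [hclose i, ha_off i hi]
  rw [hexpand]
  have hl := (abs_le.1 (hclose l)).1
  have hr := (abs_le.1 hrest).1
  nlinarith

end DiagonallyDominant

theorem exp_neg_div_le_inv_pow {h D q : ℝ} (hh : 0 < h) (hq : 0 < q)
    {k : ℕ} (hD : k * h * Real.log q ≤ D) :
    Real.exp (-D / h) ≤ (q ^ k)⁻¹ := by
  rw [← Real.exp_log (pow_pos hq k), ← Real.exp_neg, Real.log_pow]
  refine Real.exp_le_exp.2 ?_
  rw [div_le_iff₀ hh]
  linarith

/-- With `L = n + 1` labeled points that are pairwise `D`-separated, and an unlabeled point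
`u` within `2r` of the last labeled point and at distance at least `D` from all others,
the Laplace-kernel matrix is invertible and the minimum-norm interpolant
`f(u) = yᵀ K⁻¹ a_u` has the same sign as the label `y_L` of the nearby labeled point;
hence the maximin label estimate at `u` equals `y_L`. -/
theorem maximin_label_estimate_near_labeled_point (d n : ℕ) (hd : 1 ≤ d)
    (p h r D : ℝ) (hp : 1 ≤ p) (hh : 0 < h) (hr : 0 < r) (hrh : r < h / 3)
    (hD : 12 * h * Real.log (2 * ((n : ℝ) + 2)) < D)
    (x : Fin (n + 1) → (Fin d → ℝ))
    (hsep : ∀ i j, i ≠ j → D ≤ pNorm p (x i - x j))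
    (y : Fin (n + 1) → ℝ) (hy : ∀ i, y i = 1 ∨ y i = -1)
    (u : Fin d → ℝ) (hu : pNorm p (u - x (Fin.last n)) ≤ 2 * r)
    (hufar : ∀ i, i ≠ Fin.last n → D ≤ pNorm p (u - x i))
    (K : Matrix (Fin (n + 1)) (Fin (n + 1)) ℝ)
    (hK : ∀ i j, K i j = Real.exp (-pNorm p (x i - x j) / h)) :
    IsUnit K.det ∧
    0 ≤ y (Fin.last n) *
        (y ⬝ᵥ K⁻¹.mulVec (fun i => Real.exp (-pNorm p (x i - u) / h))) := by
  have hε0 : 0 ≤ Real.exp (-D / h) := (Real.exp_pos _).le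
  have hε : Real.exp (-D / h) ≤ ((2 * ((n : ℝ) + 2)) ^ 12)⁻¹ :=
    exp_neg_div_le_inv_pow hh (by positivity) (by exact_mod_cast hD.le)
  have hcard : 15 * (Fintype.card (Fin (n + 1)) : ℝ) ^ 2 * Real.exp (-D / h) ≤ 1 := by
    have hq : 15 * ((n : ℝ) + 1) ^ 2 ≤ (2 * ((n : ℝ) + 2)) ^ 12 := by
      have hn : (0 : ℝ) ≤ n := n.cast_nonneg
      calc 15 * ((n : ℝ) + 1) ^ 2 ≤ (2 * ((n : ℝ) + 2)) ^ 4 := by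
            nlinarith [pow_nonneg hn 2, pow_nonneg hn 3, pow_nonneg hn 4]
        _ ≤ (2 * ((n : ℝ) + 2)) ^ 12 := pow_le_pow_right₀ (by linarith) (by norm_num)
    rw [Fintype.card_fin, Nat.cast_add, Nat.cast_one]
    calc 15 * ((n : ℝ) + 1) ^ 2 * Real.exp (-D / h)
        ≤ (2 * ((n : ℝ) + 2)) ^ 12 * ((2 * ((n : ℝ) + 2)) ^ 12)⁻¹ := by gcongr
      _ = 1 := mul_inv_cancel₀ (by positivity)
  have hkernel : ∀ {s : ℝ}, D ≤ s → |Real.exp (-s / h)| ≤ Real.exp (-D / h) := fun hs => by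
    rw [abs_of_pos (Real.exp_pos _)]
    gcongr
  have hdiag : ∀ i, K i i = 1 := fun i => by
    rw [hK, sub_self, pNorm_zero (by linarith), neg_zero, zero_div, Real.exp_zero]
  have hoff : ∀ i j, i ≠ j → |K i j| ≤ Real.exp (-D / h) := fun i j hij => by
    rw [hK]
    exact hkernel (hsep i j hij)
  refine ⟨isUnit_det_of_diag_one_of_offDiag_le hdiag hoff hε0 ?_,
    mul_dotProduct_inv_mulVec_nonneg hdiag hoff hε0 hcard (fun i => ?_) _ ?_ (fun i hi => ?_) hy⟩
  · have hN : (1 : ℝ) ≤ Fintype.card (Fin (n + 1)) := by simp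
    nlinarith [mul_nonneg (mul_nonneg (sub_nonneg.2 hN) (zero_le_one.trans hN)) hε0]
  · rw [abs_of_pos (Real.exp_pos _), Real.exp_le_one_iff]
    exact div_nonpos_of_nonpos_of_nonneg (neg_nonpos.2 (pNorm_nonneg _ _)) hh.le
  · rw [pNorm_sub_comm]
    have hexp : -(2 / 3) ≤ -pNorm p (u - x (Fin.last n)) / h := by
      rw [le_div_iff₀ hh]
      linarith
    linarith [Real.add_one_le_exp (-pNorm p (u - x (Fin.last n)) / h)]
  · rw [pNorm_sub_comm]
    exact hkernel (hufar i hi)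
end
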